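/- Let Θ be a random angle with the reparametrized Kato–Jones mixture density f(θ) = (1/(2π)) Σ_{k=1}^m π′_k {1 + 2γ̄_k (cos(θ − μ_k) − ρ_k cos λ_k)/(1 + ρ_k² − 2ρ_k cos(θ − μ_k − λ_k))} + π′_{m+1}/(2π), where γ̄_k = (1 − ρ_k²)/(2(1 − ρ_k cos λ_k)). Then for every positive integer p, E(e^{ipΘ}) = Σ_{k=1}^m π′_k γ̄_k (ρ_k e^{iλ_k})^{−1} (ρ_k e^{i(μ_k + λ_k)})^p = Σ_{k=1}^m π′_k γ̄_k ρ_k^{p−1} e^{i(pμ_k + (p−1)λ_k)}. -/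

import Mathlib

/-- The Kato–Jones density. -/
noncomputable def gKJ (μ γ lam ρ θ : ℝ) : ℝ :=
  (1 / (2 * Real.pi)) *
    (1 + 2 * γ * (Real.cos (θ - μ) - ρ * Real.cos lam) /
      (1 + ρ ^ 2 - 2 * ρ * Real.cos (θ - μ - lam)))

/-- The maximal concentration `γ̄(ρ, λ) = (1 - ρ²)/(2(1 - ρ cos λ))`. -/
noncomputable def gammaBar (ρ lam : ℝ) : ℝ :=
  (1 - ρ ^ 2) / (2 * (1 - ρ * Real.cos lam))

theorem one_add_sq_sub_two_mul_cos_pos {ρ : ℝ} (hρ : ρ ∈ Set.Ico (0 : ℝ) 1) (x : ℝ) :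
    0 < 1 + ρ ^ 2 - 2 * ρ * Real.cos x := by
  nlinarith [Real.cos_le_one x, hρ.1, hρ.2, mul_nonneg hρ.1 (sub_nonneg.2 (Real.cos_le_one x)),
    mul_pos (sub_pos.2 hρ.2) (sub_pos.2 hρ.2)]

theorem continuous_gKJ {ρ : ℝ} (hρ : ρ ∈ Set.Ico (0 : ℝ) 1) (μ γ lam : ℝ) :
    Continuous (gKJ μ γ lam ρ) := by
  unfold gKJ
  have h (θ : ℝ) := (one_add_sq_sub_two_mul_cos_pos hρ (θ - μ - lam)).ne'
  fun_prop (disch := exact h)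

theorem gKJ_periodic (μ γ lam ρ : ℝ) : Function.Periodic (gKJ μ γ lam ρ) (2 * Real.pi) := by
  intro θ
  have h₁ : θ + 2 * Real.pi - μ = θ - μ + 2 * Real.pi := by ring
  have h₂ : θ - μ + 2 * Real.pi - lam = θ - μ - lam + 2 * Real.pi := by ring
  simp only [gKJ, h₁, h₂, Real.cos_add_two_pi]

/-- The Kato–Jones density as a rational function of `u = e^{iθ}`, with `a = ρ e^{iλ}` and
`b` its conjugate. -/
theorem gKJ_add_eq_rational (ρ μ γ lam θ : ℝ)
    {u a b : ℂ} (hu : u = Complex.exp (θ * Complex.I))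
    (ha : a = ρ * Complex.exp (lam * Complex.I)) (hb : b = ρ * Complex.exp (-(lam * Complex.I)))
    (hua : u - a ≠ 0) (hub : 1 - b * u ≠ 0) :
    (gKJ μ γ lam ρ (θ + μ) : ℂ) =
      1 / (2 * Real.pi) * (1 + γ * (u / (1 - b * u) + 1 / (u - a))) := by
  have hu0 : u ≠ 0 := hu ▸ Complex.exp_ne_zero _
  have hnum : ((Real.cos θ - ρ * Real.cos lam : ℝ) : ℂ) = (u + u⁻¹ - a - b) / 2 := by
    push_cast
    rw [hu, ha, hb, ← Complex.exp_neg, Complex.cos, Complex.cos]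
    simp only [neg_mul]
    ring
  have hden : ((1 + ρ ^ 2 - 2 * ρ * Real.cos (θ - lam) : ℝ) : ℂ) =
      (1 - b * u) * (u - a) / u := by
    push_cast
    rw [Complex.cos, hu, ha, hb]
    simp only [sub_mul, neg_sub, Complex.exp_sub, Complex.exp_neg]
    field_simp
    ring
  have h : γ * (u / (1 - b * u) + 1 / (u - a)) =
      2 * γ * ((u + u⁻¹ - a - b) / 2) / ((1 - b * u) * (u - a) / u) := by
    have hub' : 1 - u * b ≠ 0 := by rwa [mul_comm]
    field_simp
    ring
  rw [h, ← hnum, ← hden]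
  simp [gKJ]

/-- Trigonometric moments of the Kato–Jones density. -/
theorem integral_exp_mul_gKJ {ρ : ℝ} (hρ : ρ ∈ Set.Ico (0 : ℝ) 1) (μ γ lam : ℝ)
    {p : ℕ} (hp : 0 < p) :
    ∫ θ in (-Real.pi)..Real.pi, Complex.exp (Complex.I * p * θ) * (gKJ μ γ lam ρ θ : ℂ) =
      γ * (ρ : ℂ) ^ (p - 1) *
        Complex.exp (Complex.I * ((p : ℂ) * (μ : ℂ) + ((p : ℂ) - 1) * (lam : ℂ))) := by
  obtain ⟨n, rfl⟩ : ∃ n, p = n + 1 := ⟨p - 1, by omega⟩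
  set F : ℝ → ℂ := fun θ ↦
    Complex.exp (Complex.I * (n + 1 : ℕ) * θ) * (gKJ μ γ lam ρ θ : ℂ) with hF
  have hper : Function.Periodic F (2 * Real.pi) := by
    intro θ
    simp only [hF, gKJ_periodic μ γ lam ρ θ]
    congr 1
    rw [Complex.exp_eq_exp_iff_exists_int]
    exact ⟨n + 1, by push_cast; ring⟩
  set a : ℂ := ρ * Complex.exp (lam * Complex.I) with ha
  set b : ℂ := ρ * Complex.exp (-(lam * Complex.I)) with hb
  have hna : ‖a‖ < 1 := by
    rw [ha, norm_mul, Complex.norm_exp_ofReal_mul_I, Complex.norm_real, Real.norm_of_nonneg hρ.1]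
    linarith [hρ.2]
  have hnb : ‖b‖ < 1 := by
    rw [hb, ← neg_mul, ← Complex.ofReal_neg, norm_mul, Complex.norm_exp_ofReal_mul_I,
      Complex.norm_real, Real.norm_of_nonneg hρ.1]
    linarith [hρ.2]
  have hbz (z : ℂ) (hz : ‖z‖ ≤ 1) : 1 - b * z ≠ 0 := by
    intro h
    have h1 : ‖b * z‖ = 1 := by rw [← sub_eq_zero.1 h, norm_one]
    rw [norm_mul] at h1
    nlinarith [norm_nonneg b, norm_nonneg z]
  set h : ℂ → ℂ := fun z ↦
    (z - a) * z ^ n + γ * ((z - a) * z ^ (n + 1) / (1 - b * z)) + γ * z ^ n with hh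
  have hdiff : DiffContOnCl ℂ h (Metric.ball 0 1) := by
    apply DifferentiableOn.diffContOnCl
    rw [closure_ball _ one_ne_zero]
    have hb' : ∀ z ∈ Metric.closedBall (0 : ℂ) 1, 1 - b * z ≠ 0 := fun z hz ↦
      hbz z (by simpa using hz)
    simp only [hh]
    fun_prop (disch := assumption)
  have hcauchy := hdiff.circleIntegral_sub_inv_smul (w := a) (by simpa using hna)
  have hint : ∫ θ in (-Real.pi)..Real.pi, F θ = ∫ θ in (0 : ℝ)..2 * Real.pi, F (θ + μ) := by
    rw [intervalIntegral.integral_comp_add_right]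
    convert hper.intervalIntegral_add_eq (-Real.pi) (0 + μ) using 2 <;> ring
  have hpt (θ : ℝ) : F (θ + μ) =
      Complex.exp (Complex.I * ((n + 1 : ℕ) * μ)) / (2 * Real.pi * Complex.I) *
        (deriv (circleMap 0 1) θ • ((circleMap 0 1 θ - a)⁻¹ • h (circleMap 0 1 θ))) := by
    have hu : circleMap 0 1 θ = Complex.exp (θ * Complex.I) := by simp [circleMap]
    have hun : ‖circleMap 0 1 θ‖ = 1 := by simp
    have hua : circleMap 0 1 θ - a ≠ 0 := by
      intro h0
      rw [sub_eq_zero.1 h0] at hun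
      linarith
    have hub := hbz _ hun.le
    have hexp : Complex.exp (Complex.I * (n + 1 : ℕ) * (θ + μ : ℝ)) =
        Complex.exp (Complex.I * ((n + 1 : ℕ) * μ)) * circleMap 0 1 θ ^ (n + 1) := by
      rw [hu, ← Complex.exp_nat_mul, ← Complex.exp_add]
      push_cast
      ring_nf
    simp only [hF]
    rw [hexp, gKJ_add_eq_rational ρ μ γ lam θ hu ha hb hua hub, deriv_circleMap]
    simp only [hh, smul_eq_mul]
    generalize circleMap 0 1 θ = u at *
    field_simp
    ring
  have hha : h a = γ * a ^ n := by simp [hh]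
  rw [hint, intervalIntegral.integral_congr (fun θ _ ↦ hpt θ),
    intervalIntegral.integral_const_mul]
  change _ * (∮ z in C(0, 1), (z - a)⁻¹ • h z) = _
  rw [hcauchy, hha, smul_eq_mul, div_mul_eq_mul_div, mul_comm (2 * (Real.pi : ℂ) * Complex.I),
    ← mul_assoc, mul_div_cancel_right₀ _ Complex.two_pi_I_ne_zero, ha, mul_pow,
    ← Complex.exp_nat_mul, mul_add, Complex.exp_add]
  have hl : Complex.I * (((n + 1 : ℕ) - 1 : ℂ) * lam) = n * (lam * Complex.I) := by
    push_cast
    ring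
  rw [hl, Nat.add_sub_cancel]
  ring

/-- The `p`-th trigonometric moment of the reparametrized Kato–Jones mixture equals
`Σ_{k=1}^m π'_k γ̄_k ρ_k^{p−1} e^{i(pμ_k + (p−1)λ_k)}`. -/
theorem kato_jones_mixture_trig_moment
    (m : ℕ) (μ_ ρ_ lam_ : Fin m → ℝ) (w : Fin (m + 1) → ℝ)
    (hμ : ∀ k, μ_ k ∈ Set.Ico (-Real.pi) Real.pi)
    (hρ : ∀ k, ρ_ k ∈ Set.Ico (0 : ℝ) 1)
    (hlam : ∀ k, lam_ k ∈ Set.Ico (-Real.pi) Real.pi)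
    (hw : ∀ k, w k ∈ Set.Icc (0 : ℝ) 1)
    (hwsum : ∑ k, w k = 1)
    (p : ℕ) (hp : 0 < p) :
    (∫ θ in (-Real.pi)..Real.pi,
        Complex.exp (Complex.I * p * θ) *
          (((∑ k : Fin m, w k.castSucc *
              gKJ (μ_ k) (gammaBar (ρ_ k) (lam_ k)) (lam_ k) (ρ_ k) θ) +
            w (Fin.last m) / (2 * Real.pi) : ℝ) : ℂ)) =
      ∑ k : Fin m, (w k.castSucc : ℂ) * (gammaBar (ρ_ k) (lam_ k) : ℂ) *
        (ρ_ k : ℂ) ^ (p - 1) *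
        Complex.exp (Complex.I * ((p : ℂ) * (μ_ k : ℂ) + ((p : ℂ) - 1) * (lam_ k : ℂ))) := by
  have hcexp : Continuous fun θ : ℝ ↦ Complex.exp (Complex.I * p * θ) := by fun_prop
  have hc {ρ : ℝ} (h : ρ ∈ Set.Ico (0 : ℝ) 1) (μ γ lam : ℝ) (c : ℂ) :
      IntervalIntegrable (fun θ : ℝ ↦ c * (Complex.exp (Complex.I * p * θ) *
        (gKJ μ γ lam ρ θ : ℂ))) MeasureTheory.volume (-Real.pi) Real.pi :=
    (continuous_const.mul (hcexp.mul
      (Complex.continuous_ofReal.comp (continuous_gKJ h μ γ lam)))).intervalIntegrable _ _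
  have h0 : (0 : ℝ) ∈ Set.Ico (0 : ℝ) 1 := by simp
  have hpt (θ : ℝ) : Complex.exp (Complex.I * p * θ) *
      (((∑ k : Fin m, w k.castSucc *
          gKJ (μ_ k) (gammaBar (ρ_ k) (lam_ k)) (lam_ k) (ρ_ k) θ) +
        w (Fin.last m) / (2 * Real.pi) : ℝ) : ℂ) =
      (∑ k : Fin m, (w k.castSucc : ℂ) * (Complex.exp (Complex.I * p * θ) *
        (gKJ (μ_ k) (gammaBar (ρ_ k) (lam_ k)) (lam_ k) (ρ_ k) θ : ℂ))) +
      (w (Fin.last m) : ℂ) * (Complex.exp (Complex.I * p * θ) * (gKJ 0 0 0 0 θ : ℂ)) := by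
    have hunif : gKJ 0 0 0 0 θ = 1 / (2 * Real.pi) := by simp [gKJ]
    rw [hunif]
    push_cast
    rw [mul_add, Finset.mul_sum]
    congr 1
    · exact Finset.sum_congr rfl fun k _ ↦ by ring
    · ring
  have hsum : IntervalIntegrable (fun θ : ℝ ↦ ∑ k : Fin m, (w k.castSucc : ℂ) *
      (Complex.exp (Complex.I * p * θ) *
        (gKJ (μ_ k) (gammaBar (ρ_ k) (lam_ k)) (lam_ k) (ρ_ k) θ : ℂ)))
      MeasureTheory.volume (-Real.pi) Real.pi := by
    simpa only [Finset.sum_fn] using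
      IntervalIntegrable.sum Finset.univ fun k _ ↦
        hc (hρ k) (μ_ k) (gammaBar (ρ_ k) (lam_ k)) (lam_ k) (w k.castSucc)
  simp_rw [hpt]
  rw [intervalIntegral.integral_add
      hsum (hc h0 _ _ _ _),
    intervalIntegral.integral_finsetSum fun k _ ↦ hc (hρ k) _ _ _ _]
  simp_rw [intervalIntegral.integral_const_mul]
  rw [integral_exp_mul_gKJ h0 0 0 0 hp]
  simp only [Complex.ofReal_zero, zero_mul, mul_zero, add_zero]
  refine Finset.sum_congr rfl fun k _ ↦ ?_
  rw [integral_exp_mul_gKJ (hρ k) _ _ _ hp]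
  ring
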